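/- (Validity of repair bounds.) For every formula with repair sites f : Formula (α ⊕ β) and every substitution σ : β → Formula α, the result of applying the repair lies within the repair bounds: L f ⟹ subst σ f and subst σ f ⟹ U f. -/

import Mathlib

/-- Propositional formulas over a variable type `γ`. -/
inductive Formula (γ : Type*) where
  | atom (v : γ)
  | tru
  | fls
  | conj (f g : Formula γ)
  | disj (f g : Formula γ)
  | neg (f : Formula γ)

namespace Formula

/-- Evaluation of a formula under a valuation. -/
def eval {γ : Type*} (v : γ → Bool) : Formula γ → Bool
  | atom a => v a
  | tru => true
  | fls => false
  | conj f g => eval v f && eval v g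
  | disj f g => eval v f || eval v g
  | neg f => !(eval v f)

/-- Substitution: replaces each atom `Sum.inl a` by `atom a` and each
repair-site atom `Sum.inr b` by `σ b`. -/
def subst {α β : Type*} (σ : β → Formula α) : Formula (α ⊕ β) → Formula α
  | atom (Sum.inl a) => atom a
  | atom (Sum.inr b) => σ b
  | tru => tru
  | fls => fls
  | conj f g => conj (subst σ f) (subst σ g)
  | disj f g => disj (subst σ f) (subst σ g)
  | neg f => neg (subst σ f)

mutual
/-- Repair lower bound. -/
def L {α β : Type*} : Formula (α ⊕ β) → Formula α
  | atom (Sum.inl a) => atom a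
  | atom (Sum.inr _) => fls
  | tru => tru
  | fls => fls
  | conj f g => conj (L f) (L g)
  | disj f g => disj (L f) (L g)
  | neg f => neg (U f)

/-- Repair upper bound. -/
def U {α β : Type*} : Formula (α ⊕ β) → Formula α
  | atom (Sum.inl a) => atom a
  | atom (Sum.inr _) => tru
  | tru => tru
  | fls => fls
  | conj f g => conj (U f) (U g)
  | disj f g => disj (U f) (U g)
  | neg f => neg (L f)
end

/-- `f ⟹ g`: every valuation making `f` true makes `g` true. -/
def Imp {α : Type*} (f g : Formula α) : Prop :=
  ∀ v : α → Bool, eval v f = true → eval v g = true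

/-- `f ≡ g`: `f` and `g` evaluate identically under every valuation. -/
def Equiv {α : Type*} (f g : Formula α) : Prop :=
  ∀ v : α → Bool, eval v f = eval v g

end Formula

/-- (Validity of repair bounds.) Applying any repair yields a formula within the
repair bounds: `L f ⟹ subst σ f` and `subst σ f ⟹ U f`. -/
theorem repair_bounds_valid {α β : Type*} (f : Formula (α ⊕ β)) (σ : β → Formula α) :
    Formula.Imp (Formula.L f) (Formula.subst σ f) ∧
      Formula.Imp (Formula.subst σ f) (Formula.U f) := by
  induction f with
  | atom x => cases x <;> simp [Formula.Imp, Formula.L, Formula.U, Formula.subst, Formula.eval]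
  | tru => simp [Formula.Imp, Formula.L, Formula.U, Formula.subst, Formula.eval]
  | fls => simp [Formula.Imp, Formula.L, Formula.U, Formula.subst, Formula.eval]
  | conj f g ihf ihg =>
    simp only [Formula.Imp, Formula.L, Formula.U, Formula.subst, Formula.eval,
      Bool.and_eq_true] at *
    exact ⟨fun v h => ⟨ihf.1 v h.1, ihg.1 v h.2⟩, fun v h => ⟨ihf.2 v h.1, ihg.2 v h.2⟩⟩
  | disj f g ihf ihg =>
    simp only [Formula.Imp, Formula.L, Formula.U, Formula.subst, Formula.eval,
      Bool.or_eq_true] at *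
    exact ⟨fun v => Or.imp (ihf.1 v) (ihg.1 v), fun v => Or.imp (ihf.2 v) (ihg.2 v)⟩
  | neg f ih =>
    simp only [Formula.Imp, Formula.L, Formula.U, Formula.subst, Formula.eval,
      Bool.not_eq_true', ← Bool.not_eq_true] at *
    exact ⟨fun v => mt (ih.2 v), fun v => mt (ih.1 v)⟩
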